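/- Let p ≥ 1, let u be a real polynomial of degree at most p, let h_L, h_R be real polynomials with h_L(−1) = 1, h_L(1) = 0, h_R(−1) = 0, h_R(1) = 1, each satisfying the GLSFR condition of order p, and let u^I_L, u^I_R be real numbers. Define w = −u' − (u^I_L − u(−1)) h_L' − (u^I_R − u(1)) h_R'. Then ∫_{-1}^{1} u(ξ) w(ξ) dξ = (1/2)(2 u^I_L − u(−1)) u(−1) − (1/2)(2 u^I_R − u(1)) u(1). -/

import Mathlib

open Polynomial

/-- A real polynomial `h` satisfies the GLSFR condition of order `p` if
`∫_{-1}^{1} h(ξ) u'(ξ) dξ = 0` for every real polynomial `u` of degree at most `p`. -/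
def GLSFRCondition (p : ℕ) (h : Polynomial ℝ) : Prop :=
  ∀ u : Polynomial ℝ, u.natDegree ≤ p →
    (∫ ξ in (-1:ℝ)..1, h.eval ξ * ((Polynomial.derivative u).eval ξ)) = 0

theorem integral_eval_mul_derivative (f g : Polynomial ℝ) (a b : ℝ) :
    (∫ ξ in a..b, f.eval ξ * (Polynomial.derivative g).eval ξ) =
      f.eval b * g.eval b - f.eval a * g.eval a -
        ∫ ξ in a..b, g.eval ξ * (Polynomial.derivative f).eval ξ := by
  rw [intervalIntegral.integral_mul_deriv_eq_deriv_mul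
    (fun x _ => f.hasDerivAt x) (fun x _ => g.hasDerivAt x)
    ((Polynomial.derivative f).continuous.intervalIntegrable a b)
    ((Polynomial.derivative g).continuous.intervalIntegrable a b)]
  simp only [mul_comm (eval _ g)]

theorem glsfr_energy_boundary_transfer (p : ℕ) (hp : 1 ≤ p)
    (u : Polynomial ℝ) (hu : u.natDegree ≤ p) (hL hR : Polynomial ℝ)
    (hbcL1 : hL.eval (-1 : ℝ) = 1) (hbcL2 : hL.eval (1 : ℝ) = 0)
    (hbcR1 : hR.eval (-1 : ℝ) = 0) (hbcR2 : hR.eval (1 : ℝ) = 1)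
    (hstabL : GLSFRCondition p hL) (hstabR : GLSFRCondition p hR)
    (uIL uIR : ℝ) (w : Polynomial ℝ)
    (hw : w = -Polynomial.derivative u
        - Polynomial.C (uIL - u.eval (-1 : ℝ)) * Polynomial.derivative hL
        - Polynomial.C (uIR - u.eval (1 : ℝ)) * Polynomial.derivative hR) :
    (∫ ξ in (-1:ℝ)..1, u.eval ξ * w.eval ξ) =
      (1 / 2) * (2 * uIL - u.eval (-1 : ℝ)) * u.eval (-1 : ℝ)
        - (1 / 2) * (2 * uIR - u.eval (1 : ℝ)) * u.eval (1 : ℝ) := by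
  have integrable_mul (f g : Polynomial ℝ) : IntervalIntegrable
      (fun ξ => f.eval ξ * g.eval ξ) MeasureTheory.volume (-1) 1 :=
    (f.continuous.mul g.continuous).intervalIntegrable _ _
  have huu := integral_eval_mul_derivative u u (-1) 1
  have huL := integral_eval_mul_derivative u hL (-1) 1
  have huR := integral_eval_mul_derivative u hR (-1) 1
  rw [hstabL u hu, hbcL1, hbcL2] at huL
  rw [hstabR u hu, hbcR1, hbcR2] at huR
  have hsplit : ∀ ξ : ℝ, u.eval ξ * w.eval ξ =
      -1 * (u.eval ξ * (Polynomial.derivative u).eval ξ)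
        - (uIL - u.eval (-1)) * (u.eval ξ * (Polynomial.derivative hL).eval ξ)
        - (uIR - u.eval 1) * (u.eval ξ * (Polynomial.derivative hR).eval ξ) := by
    intro ξ
    simp only [hw, eval_sub, eval_neg, eval_mul, eval_C]
    ring
  simp only [hsplit]
  rw [intervalIntegral.integral_sub
      (((integrable_mul u _).const_mul _).sub ((integrable_mul u _).const_mul _))
      ((integrable_mul u _).const_mul _),
    intervalIntegral.integral_sub ((integrable_mul u _).const_mul _) ((integrable_mul u _).const_mul _),
    intervalIntegral.integral_const_mul, intervalIntegral.integral_const_mul,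
    intervalIntegral.integral_const_mul, huL, huR]
  linear_combination (-1 / 2) * huu
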